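/- arXiv:1602.06794 — 3 statements merged into one kernel-verified Lean document; each statement's English description precedes it below -/
import Mathlib

section
/- Fix (x,y) ∈ ℝⁿ×ℝᵐ with y ≥ 0 and ε ≥ 0. Then the following three sets coincide: (i) the ε-subdifferential of the indicator function of ℝⁿ×ℝ^m₊ at (x,y), i.e. {v ∈ ℝⁿ×ℝᵐ : ⟨v, (x',y') − (x,y)⟩ ≤ ε for all (x',y') with y' ≥ 0}; (ii) the ε-enlargement N^{[ε]}_{ℝⁿ×ℝ^m₊}(x,y) of the normal cone operator of ℝⁿ×ℝ^m₊; (iii) the set {(0,−w) : w ∈ ℝᵐ, w ≥ 0, ⟨y,w⟩ ≤ ε}. -/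
open scoped RealInnerProductSpace

/-- A real number whose nonnegative multiples are bounded above is nonpositive. -/
lemma nonpos_of_forall_nonneg_mul_le {a ε : ℝ} (h : ∀ t : ℝ, 0 ≤ t → t * a ≤ ε) : a ≤ 0 := by
  by_contra! ha
  have hε : 0 ≤ ε := by simpa using h 0 le_rfl
  have := h ((ε + 1) / a) (by positivity)
  rw [div_mul_cancel₀ _ ha.ne'] at this
  linarith

lemma EuclideanSpace.inner_nonneg_of_nonneg {ι : Type*} [Fintype ι] {y w : EuclideanSpace ℝ ι}
    (hy : ∀ i, 0 ≤ y i) (hw : ∀ i, 0 ≤ w i) : 0 ≤ ⟪y, w⟫ := by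
  rw [PiLp.inner_apply]
  exact Finset.sum_nonneg fun i _ => by simpa using mul_nonneg (hw i) (hy i)

/-- For `y ≥ 0` and `ε ≥ 0`, the `ε`-subdifferential of the indicator function of
`ℝⁿ×ℝ^m₊` at `(x,y)`, the `ε`-enlargement of the normal cone operator of `ℝⁿ×ℝ^m₊` at `(x,y)`, and
the set `{(0,−w) : w ≥ 0, ⟨y,w⟩ ≤ ε}` all coincide.  Inner products on the product space are
written componentwise. -/
theorem stmt3 {n m : ℕ} (x : EuclideanSpace ℝ (Fin n)) (y : EuclideanSpace ℝ (Fin m))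
    (hy : ∀ i, 0 ≤ y i) (ε : ℝ) (hε : 0 ≤ ε) :
    -- (i) the ε-subdifferential of the indicator of ℝⁿ×ℝ^m₊ at (x,y)
    ({v : EuclideanSpace ℝ (Fin n) × EuclideanSpace ℝ (Fin m) |
        ∀ (x' : EuclideanSpace ℝ (Fin n)) (y' : EuclideanSpace ℝ (Fin m)),
          (∀ i, 0 ≤ y' i) → ⟪v.1, x' - x⟫ + ⟪v.2, y' - y⟫ ≤ ε}
      -- (ii) the ε-enlargement of the normal cone operator at (x,y)
      = {v : EuclideanSpace ℝ (Fin n) × EuclideanSpace ℝ (Fin m) |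
          ∀ (z u : EuclideanSpace ℝ (Fin n) × EuclideanSpace ℝ (Fin m)),
            ((∀ i, 0 ≤ z.2 i) ∧
              ∀ (x' : EuclideanSpace ℝ (Fin n)) (y' : EuclideanSpace ℝ (Fin m)),
                (∀ i, 0 ≤ y' i) → ⟪u.1, x' - z.1⟫ + ⟪u.2, y' - z.2⟫ ≤ 0) →
              -ε ≤ ⟪x - z.1, v.1 - u.1⟫ + ⟪y - z.2, v.2 - u.2⟫}) ∧
    -- (ii) = (iii)
    ({v : EuclideanSpace ℝ (Fin n) × EuclideanSpace ℝ (Fin m) |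
        ∀ (z u : EuclideanSpace ℝ (Fin n) × EuclideanSpace ℝ (Fin m)),
          ((∀ i, 0 ≤ z.2 i) ∧
            ∀ (x' : EuclideanSpace ℝ (Fin n)) (y' : EuclideanSpace ℝ (Fin m)),
              (∀ i, 0 ≤ y' i) → ⟪u.1, x' - z.1⟫ + ⟪u.2, y' - z.2⟫ ≤ 0) →
            -ε ≤ ⟪x - z.1, v.1 - u.1⟫ + ⟪y - z.2, v.2 - u.2⟫}
      = {v : EuclideanSpace ℝ (Fin n) × EuclideanSpace ℝ (Fin m) |
          ∃ w : EuclideanSpace ℝ (Fin m),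
            (∀ i, 0 ≤ w i) ∧ ⟪y, w⟫ ≤ ε ∧ v = (0, -w)}) := by
  have subdiff_sub_enlargement : ∀ v : EuclideanSpace ℝ (Fin n) × EuclideanSpace ℝ (Fin m),
      (∀ (x' : EuclideanSpace ℝ (Fin n)) (y' : EuclideanSpace ℝ (Fin m)),
        (∀ i, 0 ≤ y' i) → ⟪v.1, x' - x⟫ + ⟪v.2, y' - y⟫ ≤ ε) →
      ∀ (z u : EuclideanSpace ℝ (Fin n) × EuclideanSpace ℝ (Fin m)),
        ((∀ i, 0 ≤ z.2 i) ∧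
          ∀ (x' : EuclideanSpace ℝ (Fin n)) (y' : EuclideanSpace ℝ (Fin m)),
            (∀ i, 0 ≤ y' i) → ⟪u.1, x' - z.1⟫ + ⟪u.2, y' - z.2⟫ ≤ 0) →
          -ε ≤ ⟪x - z.1, v.1 - u.1⟫ + ⟪y - z.2, v.2 - u.2⟫ := by
    rintro v hv z u ⟨hz, hu⟩
    have hvz := hv z.1 z.2 hz
    have huy := hu x y hy
    rw [real_inner_comm (v.1 - u.1), real_inner_comm (v.2 - u.2)]
    simp only [inner_sub_left, inner_sub_right] at hvz huy ⊢
    linarith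
  have enlargement_sub_explicit : ∀ v : EuclideanSpace ℝ (Fin n) × EuclideanSpace ℝ (Fin m),
      (∀ (z u : EuclideanSpace ℝ (Fin n) × EuclideanSpace ℝ (Fin m)),
        ((∀ i, 0 ≤ z.2 i) ∧
          ∀ (x' : EuclideanSpace ℝ (Fin n)) (y' : EuclideanSpace ℝ (Fin m)),
            (∀ i, 0 ≤ y' i) → ⟪u.1, x' - z.1⟫ + ⟪u.2, y' - z.2⟫ ≤ 0) →
          -ε ≤ ⟪x - z.1, v.1 - u.1⟫ + ⟪y - z.2, v.2 - u.2⟫) →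
      ∃ w : EuclideanSpace ℝ (Fin m), (∀ i, 0 ≤ w i) ∧ ⟪y, w⟫ ≤ ε ∧ v = (0, -w) := by
    rintro ⟨p, q⟩ hv
    have test (x' : EuclideanSpace ℝ (Fin n)) (y' : EuclideanSpace ℝ (Fin m))
        (hy' : ∀ i, 0 ≤ y' i) : -ε ≤ ⟪x - x', p⟫ + ⟪y - y', q⟫ := by
      simpa using hv (x', y') 0 ⟨hy', by simp⟩
    have hp : p = 0 := by
      refine (inner_self_eq_zero (𝕜 := ℝ)).1 (le_antisymm ?_ real_inner_self_nonneg)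
      refine nonpos_of_forall_nonneg_mul_le (ε := ε) fun t _ => ?_
      have := test (x + t • p) y hy
      simp only [sub_add_cancel_left, inner_neg_left, real_inner_smul_left, sub_self,
        inner_zero_left] at this
      linarith
    have hq (i : Fin m) : q i ≤ 0 := by
      refine nonpos_of_forall_nonneg_mul_le (ε := ε) fun t ht => ?_
      have := test x (y + EuclideanSpace.single i t) fun j => by
        have := hy j
        by_cases hj : j = i <;> simp [hj] <;> grind
      simp [EuclideanSpace.inner_single_left] at this
      linarith
    refine ⟨-q, fun i => by simpa using hq i, ?_, by simp [hp]⟩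
    have := test x 0 (by simp)
    simp only [sub_self, inner_zero_left, sub_zero, inner_neg_right] at this ⊢
    linarith
  have explicit_sub_subdiff : ∀ v : EuclideanSpace ℝ (Fin n) × EuclideanSpace ℝ (Fin m),
      (∃ w : EuclideanSpace ℝ (Fin m), (∀ i, 0 ≤ w i) ∧ ⟪y, w⟫ ≤ ε ∧ v = (0, -w)) →
      ∀ (x' : EuclideanSpace ℝ (Fin n)) (y' : EuclideanSpace ℝ (Fin m)),
        (∀ i, 0 ≤ y' i) → ⟪v.1, x' - x⟫ + ⟪v.2, y' - y⟫ ≤ ε := by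
    rintro _ ⟨w, hw, hyw, rfl⟩ x' y' hy'
    have := EuclideanSpace.inner_nonneg_of_nonneg hw hy'
    rw [real_inner_comm] at hyw
    simp only [inner_zero_left, inner_neg_left, inner_sub_right]
    linarith
  constructor <;> ext v
  · exact ⟨subdiff_sub_enlargement v,
      fun h => explicit_sub_subdiff v (enlargement_sub_explicit v h)⟩
  · exact ⟨enlargement_sub_explicit v,
      fun h => subdiff_sub_enlargement v (explicit_sub_subdiff v h)⟩
end

section
/- Let X ⊆ ℝⁿ and Y ⊆ ℝᵐ be convex sets and Γ : X×Y → ℝ be such that for each (x,y) ∈ X×Y the function (x',y') ↦ Γ(x',y) − Γ(x,y') is convex on X×Y. Suppose that for j = 1,…,i, (x̃_j, ỹ_j) ∈ X×Y, ε_j ≥ 0 and (p_j, q_j) ∈ ℝⁿ×ℝᵐ satisfy: for all (x,y) ∈ X×Y, Γ(x, ỹ_j) − Γ(x̃_j, y) ≥ Γ(x̃_j, ỹ_j) − Γ(x̃_j, ỹ_j) + ⟨p_j, x − x̃_j⟩ + ⟨q_j, y − ỹ_j⟩ − ε_j (i.e. (p_j,q_j) is an ε_j-subgradient of (x,y) ↦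 Γ(x,ỹ_j) − Γ(x̃_j,y) at (x̃_j,ỹ_j) relative to X×Y). Let α_1,…,α_i ≥ 0 with Σ_j α_j = 1, and define (x̃^a, ỹ^a) := Σ_j α_j (x̃_j, ỹ_j), (p^a, q^a) := Σ_j α_j (p_j, q_j), and ε^a := Σ_j α_j [ε_j + ⟨x̃_j − x̃^a, p_j⟩ + ⟨ỹ_j − ỹ^a, q_j⟩]. Then ε^a ≥ 0 and (p^a, q^a) is an ε^a-subgradient of (x,y) ↦ Γ(x, ỹ^a) − Γ(x̃^a, y) at (x̃^a, ỹ^a) relative to X×Y, i.e. for all (x,y) ∈ X×Y, Γ(x, ỹ^a) − Γ(x̃^a, y) ≥ ⟨p^a, x − x̃^a⟩ + ⟨q^a, y − ỹ^a⟩ − ε^a. -/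
open scoped RealInnerProductSpace

/-- Ergodic convex combinations of ε-subgradients of a convex-concave
saddle function are ε-subgradients: the ergodic residual `ε^a` is nonnegative and `(p^a,q^a)`
is an `ε^a`-subgradient of `(x,y) ↦ Γ(x,ỹ^a) − Γ(x̃^a,y)` at `(x̃^a,ỹ^a)` relative to `X×Y`. -/
theorem stmt18 {n m : ℕ} (X : Set (EuclideanSpace ℝ (Fin n))) (Y : Set (EuclideanSpace ℝ (Fin m)))
    (hX : Convex ℝ X) (hY : Convex ℝ Y)
    (Γ : EuclideanSpace ℝ (Fin n) → EuclideanSpace ℝ (Fin m) → ℝ)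
    (hΓ : ∀ x ∈ X, ∀ y ∈ Y,
      ConvexOn ℝ (X ×ˢ Y)
        (fun p : EuclideanSpace ℝ (Fin n) × EuclideanSpace ℝ (Fin m) => Γ p.1 y - Γ x p.2))
    (i : ℕ) (xt : Fin i → EuclideanSpace ℝ (Fin n)) (yt : Fin i → EuclideanSpace ℝ (Fin m))
    (p : Fin i → EuclideanSpace ℝ (Fin n)) (q : Fin i → EuclideanSpace ℝ (Fin m))
    (ε : Fin i → ℝ) (hεnn : ∀ j, 0 ≤ ε j)
    (hmem : ∀ j, xt j ∈ X ∧ yt j ∈ Y)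
    (hsub : ∀ j, ∀ x ∈ X, ∀ y ∈ Y,
      Γ x (yt j) - Γ (xt j) y ≥ ⟪p j, x - xt j⟫ + ⟪q j, y - yt j⟫ - ε j)
    (α : Fin i → ℝ) (hα : ∀ j, 0 ≤ α j) (hα1 : ∑ j, α j = 1)
    (xta : EuclideanSpace ℝ (Fin n)) (hxta : xta = ∑ j, α j • xt j)
    (yta : EuclideanSpace ℝ (Fin m)) (hyta : yta = ∑ j, α j • yt j)
    (pa : EuclideanSpace ℝ (Fin n)) (hpa : pa = ∑ j, α j • p j)
    (qa : EuclideanSpace ℝ (Fin m)) (hqa : qa = ∑ j, α j • q j)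
    (εa : ℝ) (hεa : εa = ∑ j, α j * (ε j + ⟪xt j - xta, p j⟫ + ⟪yt j - yta, q j⟫)) :
    0 ≤ εa ∧
      ∀ x ∈ X, ∀ y ∈ Y,
        Γ x yta - Γ xta y ≥ ⟪pa, x - xta⟫ + ⟪qa, y - yta⟫ - εa := by
  have hxtaX : xta ∈ X := hxta ▸ hX.sum_mem (fun j _ => hα j) hα1 (fun j _ => (hmem j).1)
  have hytaY : yta ∈ Y := hyta ▸ hY.sum_mem (fun j _ => hα j) hα1 (fun j _ => (hmem j).2)
  have key : ∀ x ∈ X, ∀ y ∈ Y,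
      Γ x yta - Γ xta y ≥ ⟪pa, x - xta⟫ + ⟪qa, y - yta⟫ - εa := by
    intro x hx y hy
    have jensen : Γ xta y - Γ x yta ≤ ∑ j, α j * (Γ (xt j) y - Γ x (yt j)) := by
      have h := (hΓ x hx y hy).map_sum_le (t := Finset.univ) (w := α)
        (p := fun j => (xt j, yt j)) (fun j _ => hα j) hα1 (fun j _ => hmem j)
      simpa only [Prod.fst_sum, Prod.snd_sum, Prod.smul_fst, Prod.smul_snd, smul_eq_mul,
        ← hxta, ← hyta] using h
    have average : ∑ j, α j * (Γ (xt j) y - Γ x (yt j)) ≤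
        ∑ j, α j * (ε j - ⟪p j, x - xt j⟫ - ⟪q j, y - yt j⟫) :=
      Finset.sum_le_sum fun j _ =>
        mul_le_mul_of_nonneg_left (by linarith [hsub j x hx y hy]) (hα j)
    have affine : ∑ j, α j * (ε j - ⟪p j, x - xt j⟫ - ⟪q j, y - yt j⟫) =
        εa - ⟪pa, x - xta⟫ - ⟪qa, y - yta⟫ := by
      rw [hεa, hpa, hqa, sum_inner, sum_inner, ← Finset.sum_sub_distrib,
        ← Finset.sum_sub_distrib]
      refine Finset.sum_congr rfl fun j _ => ?_
      rw [real_inner_smul_left, real_inner_smul_left, real_inner_comm (p j),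
        real_inner_comm (q j)]
      simp only [inner_sub_right]
      ring
    linarith
  refine ⟨?_, key⟩
  have h := key xta hxtaX yta hytaY
  simp only [sub_self, inner_zero_right] at h
  linarith
end

section
/- Let T ⊆ ℝᵖ×ℝᵖ be a monotone relation (⟨z−z', v−v'⟩ ≥ 0 for all (z,v),(z',v') ∈ T) with (z*, 0) ∈ T. Let σ ∈ [0,1), z₀ ∈ ℝᵖ, and suppose that for i = 1,…,N we have λ_i > 0, τ_i ∈ (0,1], ε_i ≥ 0, z̃_i, v_i, z_i ∈ ℝᵖ satisfying: v_i ∈ T^{[ε_i]}(z̃_i), ‖λ_i v_i + z̃_i − z_{i−1}‖² + 2λ_i ε_i ≤ σ²‖z̃_i − z_{i−1}‖², and z_i = z_{i−1} − τ_i λ_i v_i. Then for every i ∈ {1,…,N}: (a) (1−σ)‖z̃_i − z_{i−1}‖ ≤ ‖λ_i v_i‖ ≤ (1+σ)‖z̃_i − z_{i−1}‖ and 2λ_i ε_i ≤ σ²‖z̃_i − z_{i−1}‖²; (b) ‖z* − z_{i−1}‖² ≥ ‖z* − z_i‖² + τ_i(1−σ²)‖z̃_i − z_{i−1}‖² ≥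 ‖z* − z_i‖²; (c) ‖z* − z₀‖² ≥ ‖z* − z_i‖² + (1−σ²)·Σ_{j=1}^{i} τ_j‖z̃_j − z_{j−1}‖²; (d) ‖z* − z̃_i‖ ≤ ‖z* − z_{i−1}‖/√(1−σ²) and ‖z̃_i − z_{i−1}‖ ≤ ‖z* − z_{i−1}‖/√(1−σ²). -/
open scoped RealInnerProductSpace

theorem norm_add_le_of_relative_error {E : Type*} [SeminormedAddGroup E] {a w : E} {σ e : ℝ}
    (hσ0 : 0 ≤ σ) (he : 0 ≤ e) (herr : ‖w + a‖ ^ 2 + 2 * e ≤ σ ^ 2 * ‖a‖ ^ 2) : ‖w + a‖ ≤ σ * ‖a‖ :=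
  le_of_sq_le_sq (by rw [mul_pow]; linarith) (by positivity)

section ExtragradientStep

variable {E : Type*} [NormedAddCommGroup E] [InnerProductSpace ℝ E]

/-- One relaxed extragradient step `w` with relaxation `t`: the squared distance to a solution
decreases. Here `a` and `d` are the displacements from the current iterate to the
intermediate point and to the solution. -/
theorem norm_add_smul_sq_le_of_relative_error {a d w : E} {σ e t : ℝ} (ht0 : 0 ≤ t) (ht1 : t ≤ 1)
    (herr : ‖w + a‖ ^ 2 + 2 * e ≤ σ ^ 2 * ‖a‖ ^ 2) (hin : -e ≤ ⟪a - d, w⟫) :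
    ‖d + t • w‖ ^ 2 + t * (1 - σ ^ 2) * ‖a‖ ^ 2 ≤ ‖d‖ ^ 2 := by
  rw [norm_add_sq_real, real_inner_comm] at herr
  rw [inner_sub_left] at hin
  rw [norm_add_sq_real, inner_smul_right, norm_smul, mul_pow, Real.norm_eq_abs, sq_abs]
  have h₁ : 0 ≤ t * (σ ^ 2 * ‖a‖ ^ 2 - ‖w‖ ^ 2 - ‖a‖ ^ 2 - 2 * ⟪d, w⟫) :=
    mul_nonneg ht0 (by linarith)
  have h₂ : 0 ≤ t * (1 - t) * ‖w‖ ^ 2 :=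
    mul_nonneg (mul_nonneg ht0 (by linarith)) (sq_nonneg _)
  linarith

theorem norm_le_div_sqrt_of_relative_error {a d w : E} {σ e : ℝ} (hσ0 : 0 ≤ σ) (hσ1 : σ < 1)
    (herr : ‖w + a‖ ^ 2 + 2 * e ≤ σ ^ 2 * ‖a‖ ^ 2) (hin : -e ≤ ⟪a - d, w⟫) :
    ‖a‖ ≤ ‖d‖ / √(1 - σ ^ 2) := by
  have hs : 0 < 1 - σ ^ 2 := by nlinarith
  have h := norm_add_smul_sq_le_of_relative_error zero_le_one le_rfl herr hin
  rw [le_div_iff₀ (Real.sqrt_pos.2 hs)]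
  refine le_of_sq_le_sq ?_ (norm_nonneg d)
  rw [mul_pow, Real.sq_sqrt hs.le]
  linarith [sq_nonneg ‖d + (1 : ℝ) • w‖]

theorem norm_sub_le_div_sqrt_of_relative_error {a d w : E} {σ e : ℝ} (hσ0 : 0 ≤ σ) (hσ1 : σ < 1)
    (he : 0 ≤ e) (herr : ‖w + a‖ ^ 2 + 2 * e ≤ σ ^ 2 * ‖a‖ ^ 2) (hin : -e ≤ ⟪a - d, w⟫) :
    ‖d - a‖ ≤ ‖d‖ / √(1 - σ ^ 2) := by
  have hs : 0 < 1 - σ ^ 2 := by nlinarith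
  have h := norm_add_smul_sq_le_of_relative_error zero_le_one le_rfl herr hin
  rw [one_smul, one_mul] at h
  have htri : ‖d - a‖ ≤ ‖d + w‖ + σ * ‖a‖ := by
    calc ‖d - a‖ = ‖(d + w) - (w + a)‖ := by congr 1; abel
      _ ≤ ‖d + w‖ + ‖w + a‖ := norm_sub_le _ _
      _ ≤ ‖d + w‖ + σ * ‖a‖ := by gcongr; exact norm_add_le_of_relative_error hσ0 he herr
  rw [le_div_iff₀ (Real.sqrt_pos.2 hs)]
  refine le_of_sq_le_sq ?_ (norm_nonneg d)
  rw [mul_pow, Real.sq_sqrt hs.le]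
  calc ‖d - a‖ ^ 2 * (1 - σ ^ 2) ≤ (‖d + w‖ + σ * ‖a‖) ^ 2 * (1 - σ ^ 2) := by gcongr
    _ ≤ ‖d + w‖ ^ 2 + (1 - σ ^ 2) * ‖a‖ ^ 2 := by
      linarith [sq_nonneg (σ * ‖d + w‖ - (1 - σ ^ 2) * ‖a‖)]
    _ ≤ ‖d‖ ^ 2 := h

end ExtragradientStep

/-- Basic estimates for the relaxed hybrid proximal extragradient (r-HPE)
method: given a monotone relation `T` with `(z*,0) ∈ T` and iterates satisfying the r-HPE error
criterion and extragradient update, one has the contraction and boundedness estimates (a)–(d). -/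
theorem stmt19 {p : ℕ} (T : Set (EuclideanSpace ℝ (Fin p) × EuclideanSpace ℝ (Fin p)))
    (hmono : ∀ zv ∈ T, ∀ zv' ∈ T, 0 ≤ ⟪zv.1 - zv'.1, zv.2 - zv'.2⟫)
    (zstar : EuclideanSpace ℝ (Fin p)) (hzstar : (zstar, (0 : EuclideanSpace ℝ (Fin p))) ∈ T)
    (σ : ℝ) (hσ0 : 0 ≤ σ) (hσ1 : σ < 1) (N : ℕ)
    (z zt v : ℕ → EuclideanSpace ℝ (Fin p)) (lam τ ε : ℕ → ℝ)
    (hlam : ∀ i, 1 ≤ i → i ≤ N → 0 < lam i)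
    (hτ : ∀ i, 1 ≤ i → i ≤ N → 0 < τ i ∧ τ i ≤ 1)
    (hεnn : ∀ i, 1 ≤ i → i ≤ N → 0 ≤ ε i)
    (henl : ∀ i, 1 ≤ i → i ≤ N → ∀ zv ∈ T, -(ε i) ≤ ⟪zt i - zv.1, v i - zv.2⟫)
    (herr : ∀ i, 1 ≤ i → i ≤ N →
      ‖lam i • v i + zt i - z (i - 1)‖ ^ 2 + 2 * lam i * ε i ≤ σ ^ 2 * ‖zt i - z (i - 1)‖ ^ 2)
    (hupd : ∀ i, 1 ≤ i → i ≤ N → z i = z (i - 1) - (τ i * lam i) • v i) :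
    ∀ i, 1 ≤ i → i ≤ N →
      -- (a)
      ((1 - σ) * ‖zt i - z (i - 1)‖ ≤ ‖lam i • v i‖ ∧
        ‖lam i • v i‖ ≤ (1 + σ) * ‖zt i - z (i - 1)‖ ∧
        2 * lam i * ε i ≤ σ ^ 2 * ‖zt i - z (i - 1)‖ ^ 2) ∧
      -- (b)
      (‖zstar - z i‖ ^ 2 + τ i * (1 - σ ^ 2) * ‖zt i - z (i - 1)‖ ^ 2
          ≤ ‖zstar - z (i - 1)‖ ^ 2 ∧
        ‖zstar - z i‖ ^ 2
          ≤ ‖zstar - z i‖ ^ 2 + τ i * (1 - σ ^ 2) * ‖zt i - z (i - 1)‖ ^ 2) ∧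
      -- (c)
      (‖zstar - z i‖ ^ 2
          + (1 - σ ^ 2) * ∑ j ∈ Finset.Icc 1 i, τ j * ‖zt j - z (j - 1)‖ ^ 2
        ≤ ‖zstar - z 0‖ ^ 2) ∧
      -- (d)
      (‖zstar - zt i‖ ≤ ‖zstar - z (i - 1)‖ / Real.sqrt (1 - σ ^ 2) ∧
        ‖zt i - z (i - 1)‖ ≤ ‖zstar - z (i - 1)‖ / Real.sqrt (1 - σ ^ 2)) := by
  have hs : 0 < 1 - σ ^ 2 := by nlinarith
  have herr' : ∀ i, 1 ≤ i → i ≤ N → ‖lam i • v i + (zt i - z (i - 1))‖ ^ 2 + 2 * (lam i * ε i)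
      ≤ σ ^ 2 * ‖zt i - z (i - 1)‖ ^ 2 := by
    intro i h1 hN
    rw [← add_sub_assoc, ← mul_assoc]
    exact herr i h1 hN
  have hin : ∀ i, 1 ≤ i → i ≤ N →
      -(lam i * ε i) ≤ ⟪(zt i - z (i - 1)) - (zstar - z (i - 1)), lam i • v i⟫ := by
    intro i h1 hN
    have h := henl i h1 hN _ hzstar
    simp only [sub_zero] at h
    rw [sub_sub_sub_cancel_right, inner_smul_right, ← mul_neg]
    exact mul_le_mul_of_nonneg_left h (hlam i h1 hN).le
  have hdecr : ∀ i, 1 ≤ i → i ≤ N →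
      ‖zstar - z i‖ ^ 2 + τ i * (1 - σ ^ 2) * ‖zt i - z (i - 1)‖ ^ 2
        ≤ ‖zstar - z (i - 1)‖ ^ 2 := by
    intro i h1 hN
    have h := norm_add_smul_sq_le_of_relative_error (hτ i h1 hN).1.le (hτ i h1 hN).2
      (herr' i h1 hN) (hin i h1 hN)
    have hz : zstar - z i = zstar - z (i - 1) + τ i • lam i • v i := by
      rw [hupd i h1 hN, smul_smul]
      abel
    rwa [hz]
  have hsum : ∀ i, i ≤ N → ‖zstar - z i‖ ^ 2
      + (1 - σ ^ 2) * ∑ j ∈ Finset.Icc 1 i, τ j * ‖zt j - z (j - 1)‖ ^ 2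
        ≤ ‖zstar - z 0‖ ^ 2 := by
    intro i
    induction i with
    | zero => simp
    | succ k ih =>
      intro hk
      have h₁ := ih (by omega)
      have h₂ := hdecr (k + 1) (by omega) hk
      rw [Finset.sum_Icc_succ_top (by omega)]
      rw [Nat.add_sub_cancel] at h₂ ⊢
      linarith
  intro i h1 hN
  have he : 0 ≤ lam i * ε i := mul_nonneg (hlam i h1 hN).le (hεnn i h1 hN)
  have hnorm := norm_add_le_of_relative_error hσ0 he (herr' i h1 hN)
  have hupp := norm_le_add_norm_add (lam i • v i) (zt i - z (i - 1))
  have hlow := norm_le_add_norm_add (zt i - z (i - 1)) (lam i • v i)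
  rw [add_comm (zt i - z (i - 1))] at hlow
  refine ⟨⟨by linarith, by linarith, ?_⟩, ⟨hdecr i h1 hN, ?_⟩, hsum i hN, ?_, ?_⟩
  · linarith [herr' i h1 hN, sq_nonneg ‖lam i • v i + (zt i - z (i - 1))‖]
  · have := (hτ i h1 hN).1
    exact le_add_of_nonneg_right (by positivity)
  · simpa only [sub_sub_sub_cancel_right] using
      norm_sub_le_div_sqrt_of_relative_error hσ0 hσ1 he (herr' i h1 hN) (hin i h1 hN)
  · exact norm_le_div_sqrt_of_relative_error hσ0 hσ1 (herr' i h1 hN) (hin i h1 hN)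
end
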